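/- Let (X,π) be a totally connected (d+1)-partite weighted pure d-dimensional complex and let 0 < δ < 1. For each i ∈ [d], let j_1,…,j_d be an ordering of [d]∖{i} with ε_{i,j_1} ≥ ε_{i,j_2} ≥ ⋯ ≥ ε_{i,j_d}. Assume that for every i ∈ [d]: (1) ε_{i,j}·H_d ≤ δ²/10 for every j ≠ i, and (2) ∑_{ℓ=1}^{d} ε_{i,j_ℓ}·H_d(ℓ−1)/d ≤ (1−δ)/d. Then for every 2 ≤ k ≤ d+1 and every face τ of co-dimension k, λ2(P_τ) ≤ 2(1−δ)/((k−1)δ); that is, X is a (2(1−δ)/δ, 2(1−δ)/(2δ), …, 2(1−δ)/(dδ))-local spectral expander. -/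

import Mathlib

open Finset in
/-- A pure `d`-dimensional weighted simplicial complex, given by its facets (all of
cardinality `d+1`) together with a full-support probability distribution `pi` on the facets.
The faces of the complex are all subsets of facets. -/
structure WeightedComplex (V : Type*) [Fintype V] [DecidableEq V] (d : ℕ) where
  facets : Finset (Finset V)
  facets_nonempty : facets.Nonempty
  pure : ∀ τ ∈ facets, τ.card = d + 1
  pi : Finset V → ℝ
  pi_pos : ∀ τ ∈ facets, 0 < pi τ
  pi_eq_zero : ∀ τ, τ ∉ facets → pi τ = 0
  pi_sum_one : ∑ τ ∈ facets, pi τ = 1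

namespace WeightedComplex

variable {V : Type*} [Fintype V] [DecidableEq V] {d : ℕ}

/-- `σ` is a face of the complex (a subset of some facet). -/
def IsFace (K : WeightedComplex V d) (σ : Finset V) : Prop :=
  ∃ η ∈ K.facets, σ ⊆ η

/-- Total `π`-weight of the facets containing `τ`. -/
noncomputable def faceWeight (K : WeightedComplex V d) (τ : Finset V) : ℝ :=
  ∑ η ∈ K.facets.filter (fun η => τ ⊆ η), K.pi η

/-- `Pr_{σ ∼ π_τ}[{x,y} ⊆ σ]`: the weight of the edge `{x,y}` in the 1-skeleton of the
link of `τ`. -/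
noncomputable def linkWeight (K : WeightedComplex V d) (τ : Finset V) (x y : V) : ℝ :=
  if x = y ∨ x ∈ τ ∨ y ∈ τ then 0
  else (∑ η ∈ K.facets.filter (fun η => τ ⊆ η ∧ x ∈ η ∧ y ∈ η), K.pi η) / K.faceWeight τ

/-- The transition probability matrix `P_τ` of the simple random walk on the 1-skeleton of
the link `(X_τ, π_τ)`, padded with zeros outside the `X_τ(0) × X_τ(0)` block. -/
noncomputable def walkMatrix (K : WeightedComplex V d) (τ : Finset V) : Matrix V V ℝ :=
  Matrix.of fun x y => K.linkWeight τ x y / ∑ z, K.linkWeight τ x z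

/-- `Pr_{σ ∼ π_τ}[x ∈ σ]`. -/
noncomputable def probMem (K : WeightedComplex V d) (τ : Finset V) (x : V) : ℝ :=
  if x ∈ τ then 0 else K.faceWeight (insert x τ) / K.faceWeight τ

/-- The vertex marginal `π_{τ,0}(x) = Pr_{σ∼π_τ}[x ∈ σ] / codim(τ)`, viewed as a vector on all
of `V` (zero outside `X_τ(0)`). -/
noncomputable def vertexMarginal (K : WeightedComplex V d) (τ : Finset V) (x : V) : ℝ :=
  ((d + 1 - τ.card : ℕ) : ℝ)⁻¹ * K.probMem τ x

/-- The facets of the link `X_τ`. -/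
def linkFacets (K : WeightedComplex V d) (τ : Finset V) : Finset (Finset V) :=
  (K.facets.filter (fun η => τ ⊆ η)).image (fun η => η \ τ)

/-- The facet distribution `π_τ` of the link of `τ`. -/
noncomputable def linkPi (K : WeightedComplex V d) (τ : Finset V) (σ : Finset V) : ℝ :=
  K.pi (σ ∪ τ) / K.faceWeight τ

/-- The 1-skeleton of the link of every face of co-dimension at least 2 is connected. -/
def TotallyConnected (K : WeightedComplex V d) : Prop :=
  ∀ τ : Finset V, K.IsFace τ → τ.card + 2 ≤ d + 1 →
    ∀ x y : V, x ∉ τ → K.IsFace (insert x τ) → y ∉ τ → K.IsFace (insert y τ) →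
      Relation.ReflTransGen (fun a b => 0 < K.linkWeight τ a b) x y

end WeightedComplex

/-- The second largest eigenvalue of a random-walk transition matrix `P`: the largest point of
the real spectrum of `P` lying below the trivial top eigenvalue `1`. -/
noncomputable def lambda2 {n : Type*} [Fintype n] [DecidableEq n] (P : Matrix n n ℝ) : ℝ :=
  sSup {μ : ℝ | μ < 1 ∧ μ ∈ spectrum ℝ P}

/-- A `(d+1)`-partite pure `d`-dimensional weighted complex: each vertex has a type in
`Fin (d+1)` and every facet contains exactly one vertex of each type. -/
structure PartiteWeightedComplex (V : Type*) [Fintype V] [DecidableEq V] (d : ℕ)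
    extends WeightedComplex V d where
  vtype : V → Fin (d + 1)
  partite : ∀ τ ∈ facets, ∀ i : Fin (d + 1), (τ.filter (fun x => vtype x = i)).card = 1

namespace PartiteWeightedComplex

variable {V : Type*} [Fintype V] [DecidableEq V] {d : ℕ}

/-- `ε_{i,j}`: the maximum of `λ₂(P_τ)` over faces `τ` of type `[d] ∖ {i,j}`. -/
noncomputable def eps (K : PartiteWeightedComplex V d) (i j : Fin (d + 1)) : ℝ :=
  sSup {r : ℝ | ∃ τ : Finset V, K.toWeightedComplex.IsFace τ ∧
    τ.image K.vtype = Finset.univ \ {i, j} ∧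
    r = lambda2 (K.toWeightedComplex.walkMatrix τ)}

/-- `Δ(i)`: the number of `j ≠ i` with `ε_{i,j} > 0`. -/
noncomputable def DeltaAt (K : PartiteWeightedComplex V d) (i : Fin (d + 1)) : ℕ :=
  Set.ncard {j : Fin (d + 1) | j ≠ i ∧ 0 < K.eps i j}

/-- `Δ = max_i Δ(i)`. -/
noncomputable def DeltaMax (K : PartiteWeightedComplex V d) : ℕ :=
  Finset.univ.sup fun i => K.DeltaAt i

end PartiteWeightedComplex

/-- The `n`-th harmonic number `H_n = ∑_{m=1}^n 1/m` (with `H_0 = 0`). -/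
noncomputable def harm (n : ℕ) : ℝ := ∑ j ∈ Finset.Icc 1 n, (1 : ℝ) / (j : ℝ)

/-- The tail `H_n(m) = ∑_{j=m}^n 1/j` for `1 ≤ m ≤ n`, with the convention `H_n(0) = H_n(1)`. -/
noncomputable def harmFrom (n m : ℕ) : ℝ := ∑ j ∈ Finset.Icc (max m 1) n, (1 : ℝ) / (j : ℝ)

/-- A weighted form of the bound of a quadratic form by its largest eigenvalue. -/
theorem weighted_form_le_of_eigenvalues_le {V : Type*} [Fintype V] [DecidableEq V]
    (w : V → ℝ) (hw : ∀ x, 0 ≤ w x) (B : V → V → ℝ) (hB : ∀ x y, B x y = B y x)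
    (hB0 : ∀ x y, w x = 0 → B x y = 0) (c : ℝ) (hc : 0 ≤ c)
    (h : ∀ (f : V → ℝ) (ν : ℝ), (∃ x, w x * f x ≠ 0) →
      (∀ x, ∑ y, B x y * f y = ν * (w x * f x)) → ν ≤ c) (f : V → ℝ) :
    ∑ x, ∑ y, B x y * f x * f y ≤ c * ∑ x, w x * f x ^ 2 := by
  classical
  have hs : ∀ x, w x ≠ 0 → √(w x) ≠ 0 := fun x hx =>
    (Real.sqrt_pos.2 (lt_of_le_of_ne (hw x) (Ne.symm hx))).ne'
  have hsq : ∀ x, √(w x) * √(w x) = w x := fun x => Real.mul_self_sqrt (hw x)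
  let N : Matrix V V ℝ := Matrix.of fun x y =>
    c * (if x = y then 1 else 0) - B x y / (√(w x) * √(w y))
  have hN : N.IsHermitian := by
    ext x y
    simp [N, hB x y, eq_comm, mul_comm]
  have hpsd : N.PosSemidef := by
    rw [hN.posSemidef_iff_eigenvalues_nonneg]
    intro a
    by_contra hneg
    simp only [Pi.zero_apply, not_le] at hneg
    set t := hN.eigenvalues a with ht
    set v : V → ℝ := ⇑(hN.eigenvectorBasis a) with hv
    have hev : N.mulVec v = t • v := hN.mulVec_eigenvectorBasis a
    have hev' : ∀ x, ∑ y, B x y / (√(w x) * √(w y)) * v y = (c - t) * v x := by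
      intro x
      have := congrFun hev x
      simp only [N, Matrix.mulVec, dotProduct, Matrix.of_apply, sub_mul, Finset.sum_sub_distrib,
        mul_assoc, ite_mul, one_mul, zero_mul, mul_ite, mul_zero, Finset.sum_ite_eq,
        Finset.mem_univ, if_true, Pi.smul_apply, smul_eq_mul] at this
      linarith
    have hv0 : ∃ x, v x ≠ 0 := by
      by_contra hcon
      push Not at hcon
      have h0 : hN.eigenvectorBasis a = 0 := by
        ext x
        exact hcon x
      have := hN.eigenvectorBasis.orthonormal.1 a
      rw [h0] at this
      simp at this
    have hsupp : ∀ x, w x = 0 → v x = 0 := by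
      intro x hx
      have := hev' x
      simp only [hx, Real.sqrt_zero, zero_mul, div_zero, Finset.sum_const_zero] at this
      rcases mul_eq_zero.1 this.symm with h' | h'
      · linarith
      · exact h'
    obtain ⟨x₀, hx₀⟩ := hv0
    have hwx₀ : w x₀ ≠ 0 := fun h' => hx₀ (hsupp x₀ h')
    have := h (fun x => v x / √(w x)) (c - t) ⟨x₀, by
      exact mul_ne_zero hwx₀ (div_ne_zero hx₀ (hs _ hwx₀))⟩ (by
      intro x
      by_cases hx : w x = 0
      · simp [hB0 x _ hx, hx]
      · have h1 := hev' x
        have h2 : w x * (v x / √(w x)) = √(w x) * v x := by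
          have := hs x hx
          field_simp
          rw [pow_two, hsq]; ring
        rw [h2, mul_left_comm, ← h1, Finset.mul_sum]
        refine Finset.sum_congr rfl fun y _ => ?_
        have := hs x hx
        field_simp)
    linarith
  have hq := hpsd.dotProduct_mulVec_nonneg (fun x => √(w x) * f x)
  have hexp : star (fun x => √(w x) * f x) ⬝ᵥ N.mulVec (fun x => √(w x) * f x)
      = c * ∑ x, w x * f x ^ 2 - ∑ x, ∑ y, B x y * f x * f y := by
    simp only [dotProduct, Matrix.mulVec, N, Matrix.of_apply, sub_mul, Finset.sum_sub_distrib,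
        mul_assoc, ite_mul, one_mul, zero_mul, mul_ite, mul_zero, Finset.sum_ite_eq,
        Finset.mem_univ, if_true, Pi.star_apply, star_trivial, mul_sub, Finset.mul_sum]
    congr 1
    · refine Finset.sum_congr rfl fun x _ => ?_
      linear_combination (c * f x ^ 2) * hsq x
    · refine Finset.sum_congr rfl fun x _ => Finset.sum_congr rfl fun y _ => ?_
      by_cases hx : w x = 0
      · simp [hB0 x _ hx]
      by_cases hy : w y = 0
      · simp [hB x y, hB0 y _ hy]
      have := hs x hx
      have := hs y hy
      field_simp
  rw [hexp] at hq
  linarith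

theorem harm_succ (n : ℕ) : harm (n + 1) = harm n + 1 / ((n : ℝ) + 1) := by
  unfold harm
  rw [Finset.sum_Icc_succ_top (by omega)]
  push_cast
  rfl

theorem harm_mono : Monotone harm :=
  monotone_nat_of_le_succ fun n => by
    rw [harm_succ]
    have : (0 : ℝ) ≤ 1 / ((n : ℝ) + 1) := by positivity
    linarith

theorem one_le_harm {n : ℕ} (hn : 1 ≤ n) : 1 ≤ harm n := by
  have h := harm_mono hn
  simpa [harm] using h

theorem harmFrom_antitone (n : ℕ) : Antitone (harmFrom n) := by
  intro a b hab
  exact Finset.sum_le_sum_of_subset_of_nonneg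
    (Finset.Icc_subset_Icc_left (by omega)) fun _ _ _ => by positivity

theorem le_sum_harmFrom (d : ℕ) : (d : ℝ) ≤ ∑ ℓ : Fin d, harmFrom d ℓ := by
  rw [Fin.sum_univ_eq_sum_range (fun ℓ => harmFrom d ℓ) d]
  have h1 : ∀ ℓ ∈ Finset.range d, harmFrom d ℓ =
      ∑ m ∈ Finset.Icc 1 d, if ℓ ≤ m then (1 : ℝ) / m else 0 := by
    intro ℓ _
    rw [← Finset.sum_filter, harmFrom]
    congr 1
    ext m
    simp only [Finset.mem_Icc, Finset.mem_filter]
    omega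
  rw [Finset.sum_congr rfl h1, Finset.sum_comm]
  have h2 : ∀ m ∈ Finset.Icc 1 d,
      (1 : ℝ) ≤ ∑ ℓ ∈ Finset.range d, if ℓ ≤ m then (1 : ℝ) / m else 0 := by
    intro m hm
    rw [Finset.mem_Icc] at hm
    have hm0 : (0 : ℝ) < m := by exact_mod_cast hm.1
    calc (1 : ℝ) = ∑ ℓ ∈ Finset.range m, (1 : ℝ) / m := by
          rw [Finset.sum_const, Finset.card_range, nsmul_eq_mul]
          field_simp
      _ = ∑ ℓ ∈ Finset.range m, if ℓ ≤ m then (1 : ℝ) / m else 0 :=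
          Finset.sum_congr rfl fun ℓ hℓ => by
            rw [if_pos (Finset.mem_range.1 hℓ).le]
      _ ≤ _ := Finset.sum_le_sum_of_subset_of_nonneg
          (Finset.range_subset_range.2 hm.2) fun _ _ _ => by split_ifs <;> positivity
  have h3 := Finset.sum_le_sum h2
  simpa using h3

/-- A family with sorted harmonic weights dominates the plain sum. -/
theorem sum_le_sum_mul_harmFrom {d : ℕ} (a : Fin d → ℝ) (ha : Antitone a)
    (ha0 : ∀ ℓ, 0 ≤ a ℓ) : ∑ ℓ, a ℓ ≤ ∑ ℓ : Fin d, a ℓ * harmFrom d ℓ := by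
  rcases Nat.eq_zero_or_pos d with rfl | hd
  · simp
  have hmono : Monovary a (fun ℓ : Fin d => harmFrom d ℓ) :=
    ha.monovary fun x y hxy => harmFrom_antitone d hxy
  have h1 := hmono.sum_mul_sum_le_card_mul_sum
  simp only [Fintype.card_fin] at h1
  have h2 := mul_le_mul_of_nonneg_left (le_sum_harmFrom d)
    (Finset.sum_nonneg fun ℓ (_ : ℓ ∈ Finset.univ) => ha0 ℓ)
  have hd' : (0 : ℝ) < d := by exact_mod_cast hd
  refine le_of_mul_le_mul_left ?_ hd'
  linarith

/-- The spectral bound attached to a set `T` of remaining types with pairwise bounds `e`: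
a supersolution of the trickle-down recursion. -/
noncomputable def trickleBound {ι : Type*} (θ : ℝ) (e : ι → ℝ) (T : Finset ι) : ℝ :=
  (∑ j ∈ T, e j) / (1 - ∑ j ∈ T, e j - θ * harm (T.card - 1))

section TrickleBound

variable {ι : Type*} {δ η : ℝ} {d : ℕ} {e : ι → ℝ} {T : Finset ι}

theorem trickleBound_denom (hδ0 : 0 < δ) (hη0 : 0 ≤ η)
    (hη : η * harm d ≤ δ ^ 2 / 10) (hs : ∑ j ∈ T, e j ≤ 1 - δ) (hT : T.card ≤ d) :
    4 / 5 * δ ≤ 1 - ∑ j ∈ T, e j - 2 * η / δ * harm (T.card - 1) := by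
  have h1 : harm (T.card - 1) ≤ harm d := harm_mono (by omega)
  have h2 : 2 * η / δ * harm (T.card - 1) ≤ δ / 5 := by
    rw [div_mul_eq_mul_div, div_le_iff₀ hδ0]
    have := mul_le_mul_of_nonneg_left h1 hη0
    nlinarith
  linarith

theorem trickleBound_le (hδ0 : 0 < δ) (hη0 : 0 ≤ η)
    (hη : η * harm d ≤ δ ^ 2 / 10) (he0 : ∀ j ∈ T, 0 ≤ e j)
    (hs : ∑ j ∈ T, e j ≤ 1 - δ) (hT : T.card ≤ d) :
    trickleBound (2 * η / δ) e T ≤ 2 * (1 - δ) / δ := by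
  have hu := trickleBound_denom hδ0 hη0 hη hs hT
  have hs0 := Finset.sum_nonneg he0
  unfold trickleBound
  set u := 1 - ∑ j ∈ T, e j - 2 * η / δ * harm (T.card - 1)
  rw [div_le_div_iff₀ (by linarith) hδ0]
  nlinarith

theorem trickleBound_le_card (hδ0 : 0 < δ) (hδ1 : δ < 1) (hη0 : 0 ≤ η)
    (hη : η * harm d ≤ δ ^ 2 / 10) (he : ∀ j ∈ T, e j ≤ η)
    (hs : ∑ j ∈ T, e j ≤ 1 - δ) (hT : T.card ≤ d) (hd : 1 ≤ d) :
    trickleBound (2 * η / δ) e T ≤ T.card / 8 := by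
  have hu := trickleBound_denom hδ0 hη0 hη hs hT
  have hη1 : η ≤ δ ^ 2 / 10 := (le_mul_of_one_le_right hη0 (one_le_harm hd)).trans hη
  have hsn : ∑ j ∈ T, e j ≤ T.card * η := by
    simpa using Finset.sum_le_sum he
  unfold trickleBound
  set u := 1 - ∑ j ∈ T, e j - 2 * η / δ * harm (T.card - 1)
  rw [div_le_iff₀ (by linarith)]
  have hc : (0 : ℝ) ≤ T.card := Nat.cast_nonneg _
  have : η ≤ u / 8 := by nlinarith
  nlinarith

theorem le_trickleBound_singleton (hδ0 : 0 < δ) (hη0 : 0 ≤ η)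
    (hη : η * harm d ≤ δ ^ 2 / 10) (i : ι) (he0 : 0 ≤ e i)
    (hs : e i ≤ 1 - δ) (hd : 1 ≤ d) :
    e i ≤ trickleBound (2 * η / δ) e {i} := by
  have hu := trickleBound_denom (T := {i}) hδ0 hη0 hη (by simpa using hs) (by simpa using hd)
  unfold trickleBound
  rw [le_div_iff₀ (by linarith)]
  simp only [Finset.sum_singleton, Finset.card_singleton, harm]
  simp
  nlinarith

set_option maxHeartbeats 1000000 in
theorem sum_trickleBound_erase_le [DecidableEq ι] (hδ0 : 0 < δ) (hδ1 : δ < 1) (hη0 : 0 ≤ η)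
    (hη : η * harm d ≤ δ ^ 2 / 10) (he0 : ∀ j ∈ T, 0 ≤ e j) (he : ∀ j ∈ T, e j ≤ η)
    (hs : ∑ j ∈ T, e j ≤ 1 - δ) (hT : T.card ≤ d) (hT2 : 2 ≤ T.card) :
    ∑ j ∈ T, trickleBound (2 * η / δ) e (T.erase j) ≤
      ((T.card : ℝ) - 1) * trickleBound (2 * η / δ) e T - trickleBound (2 * η / δ) e T ^ 2 := by
  have hu := trickleBound_denom hδ0 hη0 hη hs hT
  have hη1 : η ≤ δ ^ 2 / 10 :=
    (le_mul_of_one_le_right hη0 (one_le_harm (by omega))).trans hη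
  have hsn : ∑ j ∈ T, e j ≤ T.card * η := by
    simpa using Finset.sum_le_sum he
  have hs0 := Finset.sum_nonneg he0
  obtain ⟨m, hm⟩ : ∃ m, T.card = m + 2 := ⟨T.card - 2, by omega⟩
  set s := ∑ j ∈ T, e j with hsdef
  set n : ℝ := (T.card : ℝ) with hn
  have hn2 : (2 : ℝ) ≤ n := by rw [hn]; exact_mod_cast hT2
  have hnm : n = m + 2 := by rw [hn, hm]; push_cast; rfl
  set u := 1 - s - 2 * η / δ * harm (T.card - 1) with hudef
  have hu0 : 0 < u := by linarith
  set γ := 2 * η / δ / (n - 1) with hγ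
  have hγ0 : 0 ≤ γ := by
    rw [hγ]; exact div_nonneg (by positivity) (by linarith)
  have hγn : γ * (n - 1) = 2 * η / δ := by
    rw [hγ]; exact div_mul_cancel₀ _ (by linarith)
  have hden : 0 < u + η + γ := by linarith
  have hterm : ∀ j ∈ T, trickleBound (2 * η / δ) e (T.erase j) ≤
      1 / u * ((s - e j) - (s - e j) * (e j + γ) / (u + η + γ)) := by
    intro j hj
    have hej0 := he0 j hj
    have hej := he j hj
    have hsj : ∑ i ∈ T.erase j, e i = s - e j := by
      rw [hsdef, ← Finset.add_sum_erase T e hj]; ring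
    have hsj0 : 0 ≤ s - e j := by
      rw [← hsj]; exact Finset.sum_nonneg fun i hi => he0 i (Finset.mem_of_mem_erase hi)
    have hd1 : 1 - ∑ i ∈ T.erase j, e i - 2 * η / δ * harm ((T.erase j).card - 1)
        = u + (e j + γ) := by
      rw [hsj, Finset.card_erase_of_mem hj, hudef, hm, hγ, hnm]
      simp only [Nat.add_sub_cancel, show m + 2 - 1 = m + 1 by omega, harm_succ]
      rw [show (m : ℝ) + 2 - 1 = m + 1 by ring]
      ring
    unfold trickleBound
    rw [hd1, hsj]
    have hden' : 0 < u + (e j + γ) := by linarith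
    have h1 : (e j + γ) / (u + η + γ) ≤ (e j + γ) / (u + (e j + γ)) :=
      div_le_div_of_nonneg_left (by linarith) hden' (by linarith)
    have h2 : (s - e j) / (u + (e j + γ)) =
        1 / u * ((s - e j) - (s - e j) * ((e j + γ) / (u + (e j + γ)))) := by
      field_simp
      ring
    rw [h2, mul_div_assoc]
    gcongr
  refine (Finset.sum_le_sum hterm).trans ?_
  have hsum1 : ∑ j ∈ T, (s - e j) = (n - 1) * s := by
    rw [Finset.sum_sub_distrib, Finset.sum_const, nsmul_eq_mul, ← hsdef]; ring
  have hsum2 : ∑ j ∈ T, (s - e j) * (e j + γ) = s ^ 2 - ∑ j ∈ T, e j ^ 2 + γ * ((n - 1) * s) := by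
    rw [← hsum1, Finset.mul_sum]
    calc _ = ∑ j ∈ T, (s * e j - e j ^ 2 + γ * (s - e j)) :=
          Finset.sum_congr rfl fun j _ => by ring
      _ = _ := by
          rw [Finset.sum_add_distrib, Finset.sum_sub_distrib, ← Finset.mul_sum, ← hsdef]; ring
  have hsq : ∑ j ∈ T, e j ^ 2 ≤ η * s := by
    rw [hsdef, Finset.mul_sum]
    exact Finset.sum_le_sum fun j hj => by nlinarith [he0 j hj, he j hj]
  rw [← Finset.mul_sum, Finset.sum_sub_distrib, hsum1, ← Finset.sum_div, hsum2]
  have hb : trickleBound (2 * η / δ) e T = s / u := rfl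
  rw [hb]
  have hηδ : η / δ ≤ δ / 10 := by
    rw [div_le_iff₀ hδ0]; nlinarith
  have hsγ : s * γ ≤ 2 / 5 * δ * η := by
    have h1 : s * γ ≤ n * η * γ := mul_le_mul_of_nonneg_right hsn hγ0
    have h2 : n * γ ≤ 4 * (η / δ) := by
      have : n * γ ≤ 2 * (γ * (n - 1)) := by nlinarith
      rw [hγn] at this
      calc _ ≤ _ := this
        _ = _ := by ring
    nlinarith
  have hkey : s * (η + γ) ≤ u * (γ * (n - 1) - η) := by
    have h1 : γ * (n - 1) - η = η * (2 / δ - 1) := by rw [hγn]; ring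
    have h2 : 0 ≤ 2 / δ - 1 := by
      rw [sub_nonneg, le_div_iff₀ hδ0]; linarith
    have h3 : 4 / 5 * δ * (η * (2 / δ - 1)) = η * (8 / 5 - 4 / 5 * δ) := by
      field_simp
      ring
    have h4 : 4 / 5 * δ * (η * (2 / δ - 1)) ≤ u * (η * (2 / δ - 1)) :=
      mul_le_mul_of_nonneg_right hu (mul_nonneg hη0 h2)
    rw [h1]
    nlinarith
  have hmain : s ^ 2 / u ≤ (s ^ 2 - ∑ j ∈ T, e j ^ 2 + γ * ((n - 1) * s)) / (u + η + γ) := by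
    rw [div_le_div_iff₀ hu0 hden]
    have h1 := mul_le_mul_of_nonneg_left hkey hs0
    have h2 := mul_le_mul_of_nonneg_left hsq hu0.le
    nlinarith
  have h5 : (n - 1) * (s / u) - (s / u) ^ 2 = 1 / u * ((n - 1) * s - s ^ 2 / u) := by
    ring
  rw [h5]
  gcongr

end TrickleBound

/-- Vertex masses `p`, pair masses `G` and total mass `F` of a connected 1-skeleton coming from
a pure complex whose facets have `k` vertices. -/
structure IsLinkForm {V : Type*} [Fintype V] (p : V → ℝ) (G : V → V → ℝ) (F k : ℝ) : Prop where
  nonneg : ∀ x, 0 ≤ p x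
  pair_nonneg : ∀ x y, 0 ≤ G x y
  symm : ∀ x y, G x y = G y x
  row : ∀ x, ∑ y, G x y = (k - 1) * p x
  total : ∑ x, p x = k * F
  pos : 0 < F
  one_lt : 1 < k
  conn : ∀ f : V → ℝ, (∀ x y, 0 < G x y → f x = f y) → ∀ x y, 0 < p x → 0 < p y → f x = f y

namespace IsLinkForm

variable {V : Type*} [Fintype V] {p : V → ℝ} {G : V → V → ℝ} {F k : ℝ}

theorem pair_eq_zero (h : IsLinkForm p G F k) (x y : V) (hx : p x = 0) : G x y = 0 := by
  have h1 := h.row x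
  rw [hx, mul_zero] at h1
  exact (Finset.sum_eq_zero_iff_of_nonneg fun y _ => h.pair_nonneg x y).1 h1 y
    (Finset.mem_univ y)

theorem sum_sum_right (h : IsLinkForm p G F k) (f : V → ℝ) :
    ∑ x, ∑ y, G x y * f y = (k - 1) * ∑ x, p x * f x := by
  rw [Finset.sum_comm, Finset.mul_sum]
  refine Finset.sum_congr rfl fun y _ => ?_
  rw [← Finset.sum_mul]
  simp only [h.symm _ y, h.row]
  ring

theorem sum_sq_pos (h : IsLinkForm p G F k) {f : V → ℝ} (hf : ∃ x, p x * f x ≠ 0) :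
    0 < ∑ x, p x * f x ^ 2 := by
  obtain ⟨x, hx⟩ := hf
  have h0 : ∀ x ∈ Finset.univ, 0 ≤ p x * f x ^ 2 := fun x _ =>
    mul_nonneg (h.nonneg x) (sq_nonneg _)
  refine lt_of_lt_of_le ?_ (Finset.single_le_sum h0 (Finset.mem_univ x))
  have h1 : 0 < p x := lt_of_le_of_ne (h.nonneg x) fun h' => hx (by simp [← h'])
  have h2 : f x ≠ 0 := fun h' => hx (by simp [h'])
  positivity

theorem sum_form_of_eigen {f : V → ℝ} {ν : ℝ}
    (he : ∀ x, ∑ y, G x y * f y = ν * (p x * f x)) :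
    ∑ x, ∑ y, G x y * f x * f y = ν * ∑ x, p x * f x ^ 2 := by
  rw [Finset.mul_sum]
  refine Finset.sum_congr rfl fun x _ => ?_
  calc _ = f x * ∑ y, G x y * f y := by
        rw [Finset.mul_sum]
        exact Finset.sum_congr rfl fun y _ => by ring
    _ = _ := by rw [he x]; ring

theorem eigenvalue_lt (h : IsLinkForm p G F k) {f : V → ℝ} {ν : ℝ}
    (he : ∀ x, ∑ y, G x y * f y = ν * (p x * f x)) (h0 : ∑ x, p x * f x = 0)
    (hf : ∃ x, p x * f x ≠ 0) : ν < k - 1 := by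
  by_contra hcon
  push Not at hcon
  have hS := h.sum_sq_pos hf
  have hrow : ∑ x, ∑ y, G x y * f x ^ 2 = (k - 1) * ∑ x, p x * f x ^ 2 := by
    rw [Finset.mul_sum]
    refine Finset.sum_congr rfl fun x _ => ?_
    rw [← Finset.sum_mul, h.row]; ring
  have hcol : ∑ x, ∑ y, G x y * f y ^ 2 = (k - 1) * ∑ x, p x * f x ^ 2 :=
    h.sum_sum_right fun x => f x ^ 2
  have hdir : ∑ x, ∑ y, G x y * (f x - f y) ^ 2 = 2 * (k - 1 - ν) * ∑ x, p x * f x ^ 2 := by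
    calc _ = ∑ x, ∑ y, (G x y * f x ^ 2 + G x y * f y ^ 2 - 2 * (G x y * f x * f y)) :=
          Finset.sum_congr rfl fun x _ => Finset.sum_congr rfl fun y _ => by ring
      _ = _ := by
          simp only [Finset.sum_sub_distrib, Finset.sum_add_distrib, ← Finset.mul_sum]
          rw [hrow, hcol, sum_form_of_eigen he]; ring
  have hn : ∀ x y, 0 ≤ G x y * (f x - f y) ^ 2 := fun x y =>
    mul_nonneg (h.pair_nonneg x y) (sq_nonneg _)
  have hz : ∑ x, ∑ y, G x y * (f x - f y) ^ 2 = 0 :=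
    le_antisymm (by rw [hdir]; nlinarith)
      (Finset.sum_nonneg fun x _ => Finset.sum_nonneg fun y _ => hn x y)
  have hedge : ∀ x y, 0 < G x y → f x = f y := by
    intro x y hxy
    have h1 := (Finset.sum_eq_zero_iff_of_nonneg fun x _ =>
      Finset.sum_nonneg fun y _ => hn x y).1 hz x (Finset.mem_univ x)
    have h2 := (Finset.sum_eq_zero_iff_of_nonneg fun y _ => hn x y).1 h1 y (Finset.mem_univ y)
    rcases mul_eq_zero.1 h2 with h3 | h3
    · exact absurd h3 hxy.ne'
    · exact sub_eq_zero.1 (pow_eq_zero_iff two_ne_zero |>.1 h3)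
  obtain ⟨x₀, hx₀⟩ := hf
  have hp₀ : 0 < p x₀ := lt_of_le_of_ne (h.nonneg x₀) fun h' => hx₀ (by simp [← h'])
  have hconst : ∀ x, p x * f x = p x * f x₀ := by
    intro x
    rcases (h.nonneg x).eq_or_lt with hx | hx
    · simp [← hx]
    · rw [h.conn f hedge x x₀ hx hp₀]
  rw [Finset.sum_congr rfl fun x _ => hconst x, ← Finset.sum_mul, h.total] at h0
  have hk := h.one_lt
  have hF := h.pos
  rcases mul_eq_zero.1 h0 with h1 | h1
  · have : 0 < k * F := by positivity
    exact this.ne' h1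
  · exact hx₀ (by simp [h1])

/-- A bound on the nontrivial eigenvalues bounds the centered form. -/
theorem form_le (h : IsLinkForm p G F k) {c : ℝ} (hc : 0 ≤ c)
    (hev : ∀ (f : V → ℝ) (ν : ℝ), (∃ x, p x * f x ≠ 0) → ∑ x, p x * f x = 0 →
      (∀ x, ∑ y, G x y * f y = ν * (p x * f x)) → ν < k - 1 → ν ≤ c) (f : V → ℝ) :
    ∑ x, ∑ y, G x y * f x * f y - (∑ x, p x * f x) ^ 2 / F ≤ c * ∑ x, p x * f x ^ 2 := by
  classical
  have hF := h.pos
  have key := weighted_form_le_of_eigenvalues_le p h.nonneg (fun x y => G x y - p x * p y / F)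
    (fun x y => by simp only [h.symm x y]; ring)
    (fun x y hx => by simp [h.pair_eq_zero x y hx, hx]) c hc (by
      intro g ν hg he
      have he' : ∀ x, ∑ y, G x y * g y = p x * (∑ y, p y * g y) / F + ν * (p x * g x) := by
        intro x
        rw [← he x]
        simp only [sub_mul, Finset.sum_sub_distrib]
        have : ∑ y, p x * p y / F * g y = p x * (∑ y, p y * g y) / F := by
          rw [Finset.mul_sum, Finset.sum_div]
          exact Finset.sum_congr rfl fun y _ => by ring
        rw [this]; ring
      have hs := h.sum_sum_right g
      rw [Finset.sum_congr rfl fun x _ => he' x, Finset.sum_add_distrib, ← Finset.sum_div,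
        ← Finset.sum_mul, ← Finset.mul_sum, h.total] at hs
      by_cases h0 : ∑ x, p x * g x = 0
      · have he0 : ∀ x, ∑ y, G x y * g y = ν * (p x * g x) := by
          intro x
          rw [he' x, h0]; ring
        exact hev g ν hg h0 he0 (h.eigenvalue_lt he0 h0 hg)
      · have h1 : k * F * (∑ x, p x * g x) / F = k * ∑ x, p x * g x := by
          field_simp
        rw [h1] at hs
        have : (ν + 1) * ∑ x, p x * g x = 0 := by linear_combination hs
        rcases mul_eq_zero.1 this with h2 | h2
        · linarith
        · exact absurd h2 h0) f
  have hexp : ∑ x, ∑ y, (G x y - p x * p y / F) * f x * f y =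
      ∑ x, ∑ y, G x y * f x * f y - (∑ x, p x * f x) ^ 2 / F := by
    simp only [sub_mul, Finset.sum_sub_distrib]
    congr 1
    rw [pow_two, Finset.sum_mul_sum, Finset.sum_div]
    refine Finset.sum_congr rfl fun x _ => ?_
    rw [Finset.sum_div]
    exact Finset.sum_congr rfl fun y _ => by ring
  rw [← hexp]
  exact key

/-- A bound on the centered form can be applied to the centered function. -/
theorem form_le_of_center (h : IsLinkForm p G F k) {c : ℝ}
    (hb : ∀ f : V → ℝ, ∑ x, ∑ y, G x y * f x * f y - (∑ x, p x * f x) ^ 2 / F ≤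
      c * ∑ x, p x * f x ^ 2) (f : V → ℝ) :
    ∑ x, ∑ y, G x y * f x * f y ≤ (k - 1) / k * ((∑ x, p x * f x) ^ 2 / F) +
      c * (∑ x, p x * f x ^ 2 - 1 / k * ((∑ x, p x * f x) ^ 2 / F)) := by
  have hF := h.pos
  have hk : 0 < k := by linarith [h.one_lt]
  set A := ∑ x, p x * f x with hA
  set m := A / (k * F) with hm
  have hmA : m * (k * F) = A := by rw [hm]; field_simp
  have h1 := hb fun x => f x - m
  have hlin : ∑ x, p x * (f x - m) = 0 := by
    simp only [mul_sub, Finset.sum_sub_distrib, ← Finset.sum_mul, h.total]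
    rw [← hA, ← hmA]; ring
  have hsq : ∑ x, p x * (f x - m) ^ 2 = ∑ x, p x * f x ^ 2 - m * A := by
    calc _ = ∑ x, (p x * f x ^ 2 - 2 * m * (p x * f x) + p x * m ^ 2) :=
          Finset.sum_congr rfl fun x _ => by ring
      _ = _ := by
          rw [Finset.sum_add_distrib, Finset.sum_sub_distrib, ← Finset.mul_sum,
            ← Finset.sum_mul, h.total, ← hA]
          linear_combination m * hmA
  have hform : ∑ x, ∑ y, G x y * (f x - m) * (f y - m) =
      ∑ x, ∑ y, G x y * f x * f y - (k - 1) * (m * A) := by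
    have hrow : ∑ x, ∑ y, G x y * f x = (k - 1) * A := by
      rw [hA, Finset.mul_sum]
      refine Finset.sum_congr rfl fun x _ => ?_
      rw [← Finset.sum_mul, h.row]; ring
    have hall : ∑ x, ∑ y, G x y = (k - 1) * (k * F) := by
      simp only [h.row]
      rw [← Finset.mul_sum, h.total]
    calc _ = ∑ x, ∑ y, (G x y * f x * f y - m * (G x y * f x) - m * (G x y * f y)
            + m ^ 2 * G x y) :=
          Finset.sum_congr rfl fun x _ => Finset.sum_congr rfl fun y _ => by ring
      _ = _ := by
          simp only [Finset.sum_sub_distrib, Finset.sum_add_distrib, ← Finset.mul_sum]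
          rw [hrow, hall, h.sum_sum_right, ← hA]
          linear_combination (k - 1) * m * hmA
  rw [hlin, hsq, hform] at h1
  have hmm : m * A = 1 / k * (A ^ 2 / F) := by rw [hm]; field_simp
  rw [hmm] at h1
  have : (k - 1) / k * (A ^ 2 / F) = (k - 1) * (1 / k * (A ^ 2 / F)) := by ring
  rw [this]
  simp only [ne_eq, OfNat.ofNat_ne_zero, not_false_eq_true, zero_pow, zero_div, sub_zero] at h1
  linarith

theorem sum_sq_div_of_eigen {f : V → ℝ} {g : V → ℝ}
    (he : ∀ x, ∑ y, G x y * f y = p x * g x) :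
    ∑ x, (∑ y, G x y * f y) ^ 2 / p x = ∑ x, p x * g x ^ 2 := by
  refine Finset.sum_congr rfl fun x _ => ?_
  rw [he x]
  by_cases hx : p x = 0
  · simp [hx]
  · field_simp

/-- Scalar trickle-down, with links bounded by `1/8`. -/
theorem form_le_of_links (h : IsLinkForm p G F k) (hk : 3 ≤ k)
    (hb : ∀ f : V → ℝ, ∑ x, ∑ y, G x y * f x * f y -
      1 / (k - 1) * ∑ x, (∑ y, G x y * f y) ^ 2 / p x ≤
      1 / 8 * ((k - 1) * ∑ x, p x * f x ^ 2 -
        1 / (k - 1) * ∑ x, (∑ y, G x y * f y) ^ 2 / p x)) (f : V → ℝ) :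
    ∑ x, ∑ y, G x y * f x * f y - (∑ x, p x * f x) ^ 2 / F ≤
      (k - 2) / 2 * ∑ x, p x * f x ^ 2 := by
  refine h.form_le (by linarith) ?_ f
  intro g ν hg _ he hν
  have h1 := hb g
  have hS := h.sum_sq_pos hg
  have hsq : ∑ x, (∑ y, G x y * g y) ^ 2 / p x = ν ^ 2 * ∑ x, p x * g x ^ 2 := by
    rw [sum_sq_div_of_eigen (g := fun x => ν * g x) (fun x => by rw [he x]; ring),
      Finset.mul_sum]
    exact Finset.sum_congr rfl fun x _ => by ring
  rw [hsq, sum_form_of_eigen he] at h1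
  set S := ∑ x, p x * g x ^ 2
  have hk1 : 0 < k - 1 := by linarith
  have h2 : ν - ν ^ 2 / (k - 1) ≤ 1 / 8 * ((k - 1) - ν ^ 2 / (k - 1)) := by
    refine le_of_mul_le_mul_right ?_ hS
    calc _ = ν * S - 1 / (k - 1) * (ν ^ 2 * S) := by ring
      _ ≤ _ := h1
      _ = _ := by ring
  have h3 : ν * (k - 1) - ν ^ 2 ≤ 1 / 8 * ((k - 1) ^ 2 - ν ^ 2) := by
    have := mul_le_mul_of_nonneg_right h2 hk1.le
    calc _ = (ν - ν ^ 2 / (k - 1)) * (k - 1) := by field_simp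
      _ ≤ _ := this
      _ = _ := by field_simp
  by_contra hcon
  push Not at hcon
  nlinarith [mul_pos (show 0 < k - 1 - ν by linarith) (show 0 < 7 * ν - (k - 1) by linarith)]

/-- Matrix trickle-down for a diagonal bound `b`. -/
theorem form_le_diagonal (h : IsLinkForm p G F k) (b : V → ℝ)
    (hb : ∀ f : V → ℝ, (k - 2) * ∑ x, ∑ y, G x y * f x * f y -
      ∑ x, (∑ y, G x y * f y) ^ 2 / p x ≤ ∑ x, p x * f x ^ 2 * ((k - 2) * b x - b x ^ 2))
    (hu : ∀ f : V → ℝ, ∑ x, ∑ y, G x y * f x * f y - (∑ x, p x * f x) ^ 2 / F ≤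
      (k - 2) / 2 * ∑ x, p x * f x ^ 2) (f : V → ℝ) :
    ∑ x, ∑ y, G x y * f x * f y - (∑ x, p x * f x) ^ 2 / F ≤ ∑ x, b x * (p x * f x ^ 2) := by
  classical
  have hF := h.pos
  have hout : ∀ (g : V → ℝ) (x : V), ∑ y, p x * p y / F * g y = p x * ((∑ y, p y * g y) / F) := by
    intro g x
    rw [Finset.sum_div, Finset.mul_sum]
    exact Finset.sum_congr rfl fun y _ => by ring
  have key := weighted_form_le_of_eigenvalues_le p h.nonneg
    (fun x y => G x y - p x * p y / F - if x = y then b x * p x else 0)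
    (fun x y => by
      by_cases hxy : x = y
      · subst hxy; rfl
      · simp only [h.symm x y, hxy, Ne.symm hxy, if_false]; ring)
    (fun x y hx => by simp [h.pair_eq_zero x y hx, hx]) 0 le_rfl (by
      intro g ν hg he
      by_contra hν
      push Not at hν
      set A := ∑ x, p x * g x with hA
      set m := A / F with hm
      have hmF : m * F = A := by rw [hm]; field_simp
      have he' : ∀ x, ∑ y, G x y * g y = p x * (m + (b x + ν) * g x) := by
        intro x
        have h1 := he x
        simp only [sub_mul, Finset.sum_sub_distrib, ite_mul, zero_mul, Finset.sum_ite_eq,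
          Finset.mem_univ, if_true, hout] at h1
        rw [← hA, ← hm] at h1
        linear_combination h1
      have hs := h.sum_sum_right g
      have hlin : ∑ x, p x * ((b x + ν) * g x) = -A := by
        rw [Finset.sum_congr rfl fun x _ => he' x] at hs
        simp only [mul_add, Finset.sum_add_distrib, ← Finset.sum_mul, h.total] at hs ⊢
        rw [← hA] at hs
        linear_combination hs - k * hmF
      set S := ∑ x, p x * g x ^ 2 with hS
      set SB := ∑ x, p x * g x ^ 2 * b x with hSB
      set SQ := ∑ x, p x * g x ^ 2 * b x ^ 2 with hSQ
      have hS0 : 0 < S := h.sum_sq_pos hg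
      have hform : ∑ x, ∑ y, G x y * g x * g y = m * A + SB + ν * S := by
        calc _ = ∑ x, g x * ∑ y, G x y * g y := by
              refine Finset.sum_congr rfl fun x _ => ?_
              rw [Finset.mul_sum]
              exact Finset.sum_congr rfl fun y _ => by ring
          _ = ∑ x, (m * (p x * g x) + p x * g x ^ 2 * b x + ν * (p x * g x ^ 2)) :=
              Finset.sum_congr rfl fun x _ => by rw [he' x]; ring
          _ = _ := by
              rw [Finset.sum_add_distrib, Finset.sum_add_distrib, ← Finset.mul_sum,
                ← Finset.mul_sum]
      have hsq : ∑ x, (∑ y, G x y * g y) ^ 2 / p x =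
          (k - 2) * (m * A) + SQ + 2 * ν * SB + ν ^ 2 * S := by
        rw [sum_sq_div_of_eigen he']
        calc _ = ∑ x, (m ^ 2 * p x + 2 * m * (p x * ((b x + ν) * g x)) + p x * g x ^ 2 * b x ^ 2
                + 2 * ν * (p x * g x ^ 2 * b x) + ν ^ 2 * (p x * g x ^ 2)) :=
              Finset.sum_congr rfl fun x _ => by ring
          _ = _ := by
              simp only [Finset.sum_add_distrib, ← Finset.mul_sum, h.total]
              rw [hlin]
              linear_combination (k * m) * hmF
      have hrhs : ∑ x, p x * g x ^ 2 * ((k - 2) * b x - b x ^ 2) = (k - 2) * SB - SQ := by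
        rw [hSB, hSQ, Finset.mul_sum, ← Finset.sum_sub_distrib]
        exact Finset.sum_congr rfl fun x _ => by ring
      have h1 := hb g
      have h2 := hu g
      rw [hform, hsq, hrhs] at h1
      rw [hform] at h2
      have hAA : A ^ 2 / F = m * A := by rw [hm]; ring
      rw [← hA, hAA] at h2
      nlinarith [mul_pos (mul_pos hν hν) hS0, mul_le_mul_of_nonneg_left h2 hν.le]) f
  have hexp : ∑ x, ∑ y, (G x y - p x * p y / F - if x = y then b x * p x else 0) * f x * f y =
      ∑ x, ∑ y, G x y * f x * f y - (∑ x, p x * f x) ^ 2 / F - ∑ x, b x * (p x * f x ^ 2) := by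
    simp only [sub_mul, Finset.sum_sub_distrib, ite_mul, zero_mul, Finset.sum_ite_eq,
      Finset.mem_univ, if_true]
    congr 1
    · congr 1
      rw [pow_two, Finset.sum_mul_sum, Finset.sum_div]
      refine Finset.sum_congr rfl fun x _ => ?_
      rw [Finset.sum_div]
      exact Finset.sum_congr rfl fun y _ => by ring
    · exact Finset.sum_congr rfl fun x _ => by ring
  rw [hexp] at key
  linarith

end IsLinkForm

namespace WeightedComplex

variable {V : Type*} [Fintype V] [DecidableEq V] {d : ℕ} (K : WeightedComplex V d)

/-- The unnormalized vertex marginal of the link of `σ`. -/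
noncomputable def mass (σ : Finset V) (x : V) : ℝ :=
  if x ∈ σ then 0 else K.faceWeight (insert x σ)

/-- The unnormalized edge weights of the link of `σ`. -/
noncomputable def pairMass (σ : Finset V) (x y : V) : ℝ :=
  if x ∈ σ then 0 else K.mass (insert x σ) y

theorem faceWeight_nonneg (σ : Finset V) : 0 ≤ K.faceWeight σ :=
  Finset.sum_nonneg fun η hη => (K.pi_pos η (Finset.mem_filter.1 hη).1).le

theorem faceWeight_pos_iff (σ : Finset V) : 0 < K.faceWeight σ ↔ K.IsFace σ := by
  constructor
  · intro h
    by_contra hcon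
    have : K.facets.filter (fun η => σ ⊆ η) = ∅ :=
      Finset.filter_eq_empty_iff.2 fun η hη h' => hcon ⟨η, hη, h'⟩
    rw [faceWeight, this, Finset.sum_empty] at h
    exact lt_irrefl _ h
  · rintro ⟨η, hη, h⟩
    exact Finset.sum_pos (fun η hη => K.pi_pos η (Finset.mem_filter.1 hη).1)
      ⟨η, Finset.mem_filter.2 ⟨hη, h⟩⟩

theorem faceWeight_eq_zero {σ : Finset V} (h : ¬ K.IsFace σ) : K.faceWeight σ = 0 :=
  le_antisymm (not_lt.1 fun h' => h ((K.faceWeight_pos_iff σ).1 h')) (K.faceWeight_nonneg σ)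

theorem mass_nonneg (σ : Finset V) (x : V) : 0 ≤ K.mass σ x := by
  unfold mass
  split_ifs
  · exact le_rfl
  · exact K.faceWeight_nonneg _

theorem mass_eq_zero {σ : Finset V} (h : ¬ K.IsFace σ) (x : V) : K.mass σ x = 0 := by
  unfold mass
  split_ifs
  · rfl
  · exact K.faceWeight_eq_zero fun ⟨η, hη, h'⟩ =>
      h ⟨η, hη, (Finset.subset_insert _ _).trans h'⟩

theorem mass_pos_iff (σ : Finset V) (x : V) :
    0 < K.mass σ x ↔ x ∉ σ ∧ K.IsFace (insert x σ) := by
  unfold mass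
  split_ifs with h
  · simp [h]
  · simp [h, faceWeight_pos_iff]

theorem pairMass_nonneg (σ : Finset V) (x y : V) : 0 ≤ K.pairMass σ x y := by
  unfold pairMass
  split_ifs
  · exact le_rfl
  · exact K.mass_nonneg _ _

theorem pairMass_symm (σ : Finset V) (x y : V) : K.pairMass σ x y = K.pairMass σ y x := by
  unfold pairMass mass
  rw [Finset.insert_comm x y]
  simp only [Finset.mem_insert]
  by_cases hx : x ∈ σ <;> by_cases hy : y ∈ σ <;> by_cases hxy : x = y <;>
    simp [hx, hy, hxy, eq_comm]

/-- Summing over vertices of the link is summing over the new vertices of each facet. -/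
theorem sum_mass_mul (σ : Finset V) (φ : V → ℝ) :
    ∑ z, K.mass σ z * φ z =
      ∑ η ∈ K.facets.filter (fun η => σ ⊆ η), K.pi η * ∑ z ∈ η \ σ, φ z := by
  have h1 : ∀ z, K.mass σ z * φ z = ∑ η ∈ K.facets.filter (fun η => σ ⊆ η),
      if z ∈ η \ σ then K.pi η * φ z else 0 := by
    intro z
    unfold mass faceWeight
    split_ifs with hz
    · simp [hz]
    · rw [Finset.sum_mul, ← Finset.sum_filter, Finset.filter_filter]
      refine Finset.sum_congr ?_ fun _ _ => rfl
      ext η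
      simp only [Finset.mem_filter, Finset.insert_subset_iff, Finset.mem_sdiff]
      tauto
  rw [Finset.sum_congr rfl fun z _ => h1 z, Finset.sum_comm]
  refine Finset.sum_congr rfl fun η _ => ?_
  rw [Finset.mul_sum, ← Finset.sum_filter]
  congr 1
  ext z
  simp

theorem sum_mass (σ : Finset V) :
    ∑ z, K.mass σ z = ((d : ℝ) + 1 - σ.card) * K.faceWeight σ := by
  have h := K.sum_mass_mul σ fun _ => 1
  simp only [mul_one] at h
  rw [h, faceWeight, Finset.mul_sum]
  refine Finset.sum_congr rfl fun η hη => ?_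
  rw [Finset.mem_filter] at hη
  rw [Finset.sum_const, nsmul_eq_mul, Finset.cast_card_sdiff hη.2, K.pure η hη.1]
  push_cast
  ring

theorem sum_pairMass (σ : Finset V) (x : V) :
    ∑ y, K.pairMass σ x y = ((d : ℝ) + 1 - σ.card - 1) * K.mass σ x := by
  unfold pairMass
  by_cases hx : x ∈ σ
  · simp [hx, mass]
  · simp only [hx, if_false]
    rw [sum_mass, Finset.card_insert_of_notMem hx, mass, if_neg hx]
    push_cast
    ring

theorem sum_pairMass_insert (σ : Finset V) (x y : V) :
    ∑ z, (if z ∈ σ then 0 else K.pairMass (insert z σ) x y) =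
      ((d : ℝ) + 1 - σ.card - 2) * K.pairMass σ x y := by
  have h1 : ∀ z, (if z ∈ σ then 0 else K.pairMass (insert z σ) x y) =
      if x ∈ σ then 0 else K.pairMass (insert x σ) y z := by
    intro z
    unfold pairMass mass
    rw [Finset.insert_comm x z, Finset.insert_comm y z]
    simp only [Finset.mem_insert]
    by_cases hx : x ∈ σ <;> by_cases hy : y ∈ σ <;> by_cases hz : z ∈ σ <;>
      by_cases hxy : y = x <;> by_cases hxz : z = x <;> by_cases hyz : z = y <;>
      simp_all [eq_comm]
  rw [Finset.sum_congr rfl fun z _ => h1 z]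
  by_cases hx : x ∈ σ
  · simp [hx, pairMass]
  · simp only [hx, if_false]
    rw [sum_pairMass, Finset.card_insert_of_notMem hx]
    simp only [pairMass, hx, if_false]
    push_cast
    ring

theorem linkWeight_eq (σ : Finset V) (x y : V) :
    K.linkWeight σ x y = K.pairMass σ x y / K.faceWeight σ := by
  unfold linkWeight pairMass mass
  by_cases hx : x ∈ σ
  · simp [hx]
  by_cases hy : y ∈ insert x σ
  · have : x = y ∨ x ∈ σ ∨ y ∈ σ := by
      rw [Finset.mem_insert] at hy
      tauto
    rw [if_pos this, if_neg hx, if_pos hy, zero_div]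
  · have : ¬ (x = y ∨ x ∈ σ ∨ y ∈ σ) := by
      rw [Finset.mem_insert] at hy
      tauto
    rw [if_neg this, if_neg hx, if_neg hy, faceWeight.eq_def K (insert y (insert x σ))]
    congr 2
    ext η
    simp only [Finset.mem_filter, Finset.insert_subset_iff]
    tauto

theorem walkMatrix_mulVec {σ : Finset V} (hσ : K.IsFace σ) (f : V → ℝ) (x : V) :
    (K.walkMatrix σ).mulVec f x =
      (∑ y, K.pairMass σ x y * f y) / (((d : ℝ) + 1 - σ.card - 1) * K.mass σ x) := by
  have hF := (K.faceWeight_pos_iff σ).2 hσ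
  have h1 : ∑ z, K.linkWeight σ x z =
      ((d : ℝ) + 1 - σ.card - 1) * K.mass σ x / K.faceWeight σ := by
    rw [← sum_pairMass, Finset.sum_div]
    exact Finset.sum_congr rfl fun z _ => K.linkWeight_eq σ x z
  simp only [walkMatrix, Matrix.mulVec, dotProduct, Matrix.of_apply]
  rw [h1, Finset.sum_div]
  refine Finset.sum_congr rfl fun y _ => ?_
  rw [linkWeight_eq, div_div_div_cancel_right₀ hF.ne']
  ring

theorem isLinkForm (hconn : K.TotallyConnected) {σ : Finset V} (hσ : K.IsFace σ)
    (hcard : σ.card + 2 ≤ d + 1) :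
    IsLinkForm (K.mass σ) (K.pairMass σ) (K.faceWeight σ) ((d : ℝ) + 1 - σ.card) where
  nonneg := K.mass_nonneg σ
  pair_nonneg := K.pairMass_nonneg σ
  symm := K.pairMass_symm σ
  row := K.sum_pairMass σ
  total := K.sum_mass σ
  pos := (K.faceWeight_pos_iff σ).2 hσ
  one_lt := by
    have : ((σ.card : ℝ) + 2) ≤ d + 1 := by exact_mod_cast hcard
    linarith
  conn := by
    intro f hf x y hx hy
    rw [mass_pos_iff] at hx hy
    have hF := (K.faceWeight_pos_iff σ).2 hσ
    have h := hconn σ hσ hcard x y hx.1 hx.2 hy.1 hy.2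
    induction h with
    | refl => rfl
    | @tail b c hab hbc ih =>
      have hb : 0 < K.pairMass σ b c := by
        rw [linkWeight_eq] at hbc
        exact (div_pos_iff_of_pos_right hF).1 hbc
      have hbm : 0 < K.mass σ b := by
        refine lt_of_le_of_ne (K.mass_nonneg σ b) fun h0 => ?_
        have h1 := K.sum_pairMass σ b
        rw [← h0, mul_zero] at h1
        exact hb.ne' ((Finset.sum_eq_zero_iff_of_nonneg
          fun y _ => K.pairMass_nonneg σ b y).1 h1 c (Finset.mem_univ c))
      rw [ih ((K.mass_pos_iff σ b).1 hbm)]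
      exact hf b c hb

theorem exists_eigenvector_of_mem_spectrum {n : Type*} [Fintype n] [DecidableEq n]
    {P : Matrix n n ℝ} {μ : ℝ} (h : μ ∈ spectrum ℝ P) : ∃ f ≠ 0, P.mulVec f = μ • f := by
  rw [← Matrix.spectrum_toLin', ← Module.End.hasEigenvalue_iff_mem_spectrum] at h
  obtain ⟨f, hf⟩ := h.exists_hasEigenvector
  exact ⟨f, hf.2, by simpa using hf.apply_eq_smul⟩

theorem mem_spectrum_of_eigenvector {n : Type*} [Fintype n] [DecidableEq n]
    {P : Matrix n n ℝ} {μ : ℝ} {f : n → ℝ} (hf : f ≠ 0) (h : P.mulVec f = μ • f) :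
    μ ∈ spectrum ℝ P := by
  rw [← Matrix.spectrum_toLin', ← Module.End.hasEigenvalue_iff_mem_spectrum]
  exact Module.End.hasEigenvalue_of_hasEigenvector (x := f)
    ⟨Module.End.mem_eigenspace_iff.2 (by simpa using h), hf⟩

theorem lambda2_le_one {n : Type*} [Fintype n] [DecidableEq n] (P : Matrix n n ℝ) :
    lambda2 P ≤ 1 :=
  Real.sSup_le (fun _ h => h.1.le) zero_le_one

theorem le_lambda2 {n : Type*} [Fintype n] [DecidableEq n] {P : Matrix n n ℝ} {μ : ℝ}
    (h1 : μ < 1) (h : μ ∈ spectrum ℝ P) : μ ≤ lambda2 P :=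
  le_csSup ⟨1, fun _ h => h.1.le⟩ ⟨h1, h⟩

/-- A diagonal bound on the centered form bounds the second eigenvalue of the walk. -/
theorem lambda2_le_of_form_le {σ : Finset V} (hσ : K.IsFace σ) {k : ℝ}
    (hl : IsLinkForm (K.mass σ) (K.pairMass σ) (K.faceWeight σ) k)
    (hk : k = (d : ℝ) + 1 - σ.card) {c : ℝ} (hc : 0 ≤ c)
    (hf : ∀ f : V → ℝ, ∑ x, ∑ y, K.pairMass σ x y * f x * f y -
      (∑ x, K.mass σ x * f x) ^ 2 / K.faceWeight σ ≤ c * ∑ x, K.mass σ x * f x ^ 2) :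
    lambda2 (K.walkMatrix σ) ≤ c / (k - 1) := by
  have hk1 : 0 < k - 1 := by linarith [hl.one_lt]
  have hck : 0 ≤ c / (k - 1) := div_nonneg hc hk1.le
  refine Real.sSup_le ?_ hck
  rintro μ ⟨hμ1, hμ⟩
  by_contra hcon
  push Not at hcon
  have hμ0 : 0 < μ := hck.trans_lt hcon
  obtain ⟨f, hf0, he⟩ := exists_eigenvector_of_mem_spectrum hμ
  have he1 : ∀ x, ∑ y, K.pairMass σ x y * f y = ((k - 1) * μ) * (K.mass σ x * f x) := by
    intro x
    have h1 := congrFun he x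
    rw [K.walkMatrix_mulVec hσ, ← hk, Pi.smul_apply, smul_eq_mul] at h1
    by_cases hx : K.mass σ x = 0
    · rw [hx]
      simp [hl.pair_eq_zero x _ hx]
    · rw [div_eq_iff (mul_ne_zero hk1.ne' hx)] at h1
      rw [h1]; ring
  have hex : ∃ x, K.mass σ x * f x ≠ 0 := by
    obtain ⟨x, hx⟩ := Function.ne_iff.1 hf0
    refine ⟨x, mul_ne_zero (fun h0 => ?_) hx⟩
    have h1 := congrFun he x
    rw [K.walkMatrix_mulVec hσ, h0, mul_zero, div_zero, Pi.smul_apply, smul_eq_mul] at h1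
    exact mul_ne_zero hμ0.ne' hx h1.symm
  have hmean : ∑ x, K.mass σ x * f x = 0 := by
    have h1 := hl.sum_sum_right f
    rw [Finset.sum_congr rfl fun x _ => he1 x, ← Finset.mul_sum] at h1
    have h2 : (k - 1) * (1 - μ) * ∑ x, K.mass σ x * f x = 0 := by linear_combination -h1
    exact (mul_eq_zero.1 h2).resolve_left (mul_pos hk1 (by linarith)).ne'
  have h1 := hf f
  rw [IsLinkForm.sum_form_of_eigen he1, hmean] at h1
  have hS := hl.sum_sq_pos hex
  have h2 : (k - 1) * μ ≤ c := by
    refine le_of_mul_le_mul_right ?_ hS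
    simpa using h1
  rw [div_lt_iff₀ hk1] at hcon
  linarith

/-- At co-dimension two the second eigenvalue bounds the centered form. -/
theorem form_le_of_lambda2_le {σ : Finset V} (hσ : K.IsFace σ)
    (hl : IsLinkForm (K.mass σ) (K.pairMass σ) (K.faceWeight σ) 2)
    (hcard : (d : ℝ) + 1 - σ.card = 2) {c : ℝ} (hc : 0 ≤ c)
    (h : lambda2 (K.walkMatrix σ) ≤ c) (f : V → ℝ) :
    ∑ x, ∑ y, K.pairMass σ x y * f x * f y -
      (∑ x, K.mass σ x * f x) ^ 2 / K.faceWeight σ ≤ c * ∑ x, K.mass σ x * f x ^ 2 := by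
  refine hl.form_le hc ?_ f
  intro g ν hg _ he hν
  refine le_trans (le_lambda2 (by linarith) ?_) h
  refine mem_spectrum_of_eigenvector (f := fun x => if K.mass σ x = 0 then 0 else g x) ?_ ?_
  · obtain ⟨x, hx⟩ := hg
    refine Function.ne_iff.2 ⟨x, ?_⟩
    simpa [left_ne_zero_of_mul hx] using right_ne_zero_of_mul hx
  · ext x
    rw [K.walkMatrix_mulVec hσ, hcard, Pi.smul_apply, smul_eq_mul]
    have h1 : ∑ y, K.pairMass σ x y * (if K.mass σ y = 0 then 0 else g y) =
        ∑ y, K.pairMass σ x y * g y := by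
      refine Finset.sum_congr rfl fun y _ => ?_
      split_ifs with hy
      · rw [hl.symm, hl.pair_eq_zero y x hy]; ring
      · rfl
    rw [h1, he x]
    by_cases hx : K.mass σ x = 0
    · simp [hx]
    · simp only [hx, if_false]
      field_simp
      norm_num

end WeightedComplex

namespace PartiteWeightedComplex

variable {V : Type*} [Fintype V] [DecidableEq V] {d : ℕ} (K : PartiteWeightedComplex V d)

theorem vtype_injOn {σ : Finset V} (hσ : K.IsFace σ) : Set.InjOn K.vtype σ := by
  obtain ⟨η, hη, hsub⟩ := hσ
  intro x hx y hy hxy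
  obtain ⟨a, ha⟩ := Finset.card_eq_one.1 (K.partite η hη (K.vtype y))
  have h1 : x ∈ η.filter fun z => K.vtype z = K.vtype y :=
    Finset.mem_filter.2 ⟨hsub hx, hxy⟩
  have h2 : y ∈ η.filter fun z => K.vtype z = K.vtype y :=
    Finset.mem_filter.2 ⟨hsub hy, rfl⟩
  rw [ha, Finset.mem_singleton] at h1 h2
  rw [h1, h2]

theorem image_vtype_facet {η : Finset V} (hη : η ∈ K.facets) :
    η.image K.vtype = Finset.univ := by
  ext i
  obtain ⟨a, ha⟩ := Finset.card_eq_one.1 (K.partite η hη i)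
  have h1 : a ∈ η.filter fun z => K.vtype z = i := by simp [ha]
  rw [Finset.mem_filter] at h1
  simp only [Finset.mem_image, Finset.mem_univ, iff_true]
  exact ⟨a, h1⟩

/-- The types missing from `σ`. -/
def missing (σ : Finset V) : Finset (Fin (d + 1)) := Finset.univ \ σ.image K.vtype

theorem card_missing {σ : Finset V} (hσ : K.IsFace σ) :
    (K.missing σ).card + σ.card = d + 1 := by
  have h := Finset.card_sdiff_add_card_eq_card (Finset.subset_univ (σ.image K.vtype))
  rw [Finset.card_image_of_injOn (K.vtype_injOn hσ), Finset.card_univ, Fintype.card_fin] at h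
  exact h

theorem missing_insert (σ : Finset V) (x : V) :
    K.missing (insert x σ) = (K.missing σ).erase (K.vtype x) := by
  ext i
  simp only [missing, Finset.image_insert, Finset.mem_sdiff, Finset.mem_univ, true_and,
    Finset.mem_insert, Finset.mem_erase]
  tauto

theorem vtype_mem_missing {σ : Finset V} {x : V} (hx : x ∉ σ) (h : K.IsFace (insert x σ)) :
    K.vtype x ∈ K.missing σ := by
  simp only [missing, Finset.mem_sdiff, Finset.mem_univ, true_and, Finset.mem_image]
  rintro ⟨y, hy, hxy⟩
  have := K.vtype_injOn h (by simp [hy]) (by simp) hxy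
  exact hx (this ▸ hy)

theorem sum_mass_mul_vtype (σ : Finset V) (φ : Fin (d + 1) → ℝ) :
    ∑ z, K.mass σ z * φ (K.vtype z) = K.faceWeight σ * ∑ j ∈ K.missing σ, φ j := by
  rw [K.sum_mass_mul σ fun z => φ (K.vtype z), WeightedComplex.faceWeight, Finset.sum_mul]
  refine Finset.sum_congr rfl fun η hη => ?_
  rw [Finset.mem_filter] at hη
  have hinj : Set.InjOn K.vtype η := K.vtype_injOn ⟨η, hη.1, subset_rfl⟩
  have himg : (η \ σ).image K.vtype = K.missing σ := by
    rw [Finset.image_sdiff_of_injOn hinj hη.2, K.image_vtype_facet hη.1, missing]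
  rw [← himg, Finset.sum_image (hinj.mono (by simp))]

theorem eps_comm (i j : Fin (d + 1)) : K.eps i j = K.eps j i := by
  unfold eps
  rw [Finset.pair_comm]

theorem lambda2_le_eps {τ : Finset V} (hτ : K.IsFace τ) {i j : Fin (d + 1)}
    (h : K.missing τ = {i, j}) : lambda2 (K.walkMatrix τ) ≤ K.eps i j := by
  refine le_csSup ⟨1, ?_⟩ ⟨τ, hτ, ?_, rfl⟩
  · rintro r ⟨σ, -, -, rfl⟩
    exact WeightedComplex.lambda2_le_one _
  · rw [← h, missing]
    simp

theorem eps_nonneg (hd : 2 ≤ d) (i j : Fin (d + 1)) : 0 ≤ K.eps i j := by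
  refine Real.sSup_nonneg ?_
  rintro r ⟨τ, hτ, himg, rfl⟩
  have hne : τ.Nonempty := by
    rw [← Finset.image_nonempty (f := K.vtype), himg, ← Finset.card_pos]
    have h1 := Finset.le_card_sdiff {i, j} (Finset.univ : Finset (Fin (d + 1)))
    have h2 := Finset.card_le_two (a := i) (b := j)
    rw [Finset.card_univ, Fintype.card_fin] at h1
    omega
  obtain ⟨x, hx⟩ := hne
  refine WeightedComplex.le_lambda2 zero_lt_one
    (WeightedComplex.mem_spectrum_of_eigenvector (f := Pi.single x 1) (by simp) ?_)
  ext y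
  rw [K.walkMatrix_mulVec hτ, zero_smul, Pi.zero_apply]
  have : K.pairMass τ y x = 0 := by
    rw [K.pairMass_symm, WeightedComplex.pairMass, if_pos hx]
  simp [Pi.single_apply, this]

/-- The nonnegative part of `ε_{i,j}`. -/
noncomputable def epsPos (i j : Fin (d + 1)) : ℝ := max (K.eps i j) 0

theorem sum_eps_le (hd : 2 ≤ d) {c : ℝ} (i : Fin (d + 1))
    (h2 : ∀ j : Fin d → Fin (d + 1), Function.Injective j →
      (∀ ℓ, j ℓ ≠ i) →
      (∀ ℓ ℓ' : Fin d, ℓ ≤ ℓ' → K.eps i (j ℓ') ≤ K.eps i (j ℓ)) →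
      ∑ ℓ : Fin d, K.eps i (j ℓ) * harmFrom d (ℓ : ℕ) / (d : ℝ) ≤ c / (d : ℝ)) :
    ∑ ℓ : Fin d, K.eps i (i.succAbove ℓ) ≤ c := by
  let g : Fin d → ℝ := fun ℓ => -K.eps i (i.succAbove ℓ)
  have hanti : ∀ ℓ ℓ' : Fin d, ℓ ≤ ℓ' →
      K.eps i (i.succAbove (Tuple.sort g ℓ')) ≤ K.eps i (i.succAbove (Tuple.sort g ℓ)) :=
    fun ℓ ℓ' hℓ => neg_le_neg_iff.1 (Tuple.monotone_sort g hℓ)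
  have h := h2 (fun ℓ => i.succAbove (Tuple.sort g ℓ))
    (fun a b hab => (Tuple.sort g).injective (Fin.succAbove_right_injective hab))
    (fun ℓ => Fin.succAbove_ne i _) hanti
  have hd0 : (0 : ℝ) < d := by exact_mod_cast (by omega : 0 < d)
  rw [← Finset.sum_div, div_le_div_iff_of_pos_right hd0] at h
  refine le_trans ?_ h
  rw [← Equiv.sum_comp (Tuple.sort g)]
  exact sum_le_sum_mul_harmFrom _ (fun ℓ ℓ' hℓ => hanti ℓ ℓ' hℓ)
    fun ℓ => K.eps_nonneg hd _ _

theorem sum_epsPos_le (hd : 1 ≤ d) {c : ℝ} (hc : 0 ≤ c) (i : Fin (d + 1))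
    (h2 : ∀ j : Fin d → Fin (d + 1), Function.Injective j →
      (∀ ℓ, j ℓ ≠ i) →
      (∀ ℓ ℓ' : Fin d, ℓ ≤ ℓ' → K.eps i (j ℓ') ≤ K.eps i (j ℓ)) →
      ∑ ℓ : Fin d, K.eps i (j ℓ) * harmFrom d (ℓ : ℕ) / (d : ℝ) ≤ c / (d : ℝ))
    (T : Finset (Fin (d + 1))) (hi : i ∉ T) : ∑ j ∈ T, K.epsPos i j ≤ c := by
  have hle : ∑ j ∈ T, K.epsPos i j ≤ ∑ ℓ : Fin d, K.epsPos i (i.succAbove ℓ) := by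
    have h := Fin.sum_univ_succAbove (fun j => K.epsPos i j) i
    have h' : ∑ j ∈ T, K.epsPos i j ≤ ∑ j ∈ Finset.univ.erase i, K.epsPos i j :=
      Finset.sum_le_sum_of_subset_of_nonneg
        (fun j hj => Finset.mem_erase.2 ⟨fun h => hi (h ▸ hj), Finset.mem_univ j⟩)
        fun j _ _ => le_max_right _ _
    rw [← Finset.add_sum_erase _ _ (Finset.mem_univ i)] at h
    linarith
  refine hle.trans ?_
  rcases (by omega : d = 1 ∨ 2 ≤ d) with rfl | hd2
  · have h := h2 i.succAbove Fin.succAbove_right_injective (Fin.succAbove_ne i)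
      (fun ℓ ℓ' _ => by rw [Subsingleton.elim ℓ ℓ'])
    simpa [harmFrom, epsPos, hc] using h
  · have : ∀ j, K.epsPos i j = K.eps i j := fun j => max_eq_left (K.eps_nonneg hd2 i j)
    simp only [this]
    exact K.sum_eps_le hd2 i h2

/-- The diagonal bound for the link of `τ` at the vertex `x`. -/
noncomputable def diagBound (θ : ℝ) (τ : Finset V) (x : V) : ℝ :=
  trickleBound θ (K.epsPos (K.vtype x)) (K.missing (insert x τ))

theorem vtype_notMem_missing_insert (τ : Finset V) (x : V) :
    K.vtype x ∉ K.missing (insert x τ) := by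
  rw [missing_insert]
  exact Finset.notMem_erase _ _

section Trickle

variable {δ η : ℝ}

theorem diagBound_le (hδ0 : 0 < δ) (hη0 : 0 ≤ η) (hη : η * harm d ≤ δ ^ 2 / 10)
    (hs : ∀ (i : Fin (d + 1)) (T : Finset (Fin (d + 1))), i ∉ T →
      ∑ j ∈ T, K.epsPos i j ≤ 1 - δ) {τ : Finset V} {x : V} (hx : 0 < K.mass τ x) :
    K.diagBound (2 * η / δ) τ x ≤ 2 * (1 - δ) / δ := by
  rw [WeightedComplex.mass_pos_iff] at hx
  have hc := K.card_missing hx.2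
  rw [Finset.card_insert_of_notMem hx.1] at hc
  exact trickleBound_le hδ0 hη0 hη (fun j _ => le_max_right _ _)
    (hs _ _ (K.vtype_notMem_missing_insert τ x)) (by omega)

theorem form_le_diagBound_two (hconn : K.TotallyConnected)
    (hδ0 : 0 < δ) (hη0 : 0 ≤ η) (hη : η * harm d ≤ δ ^ 2 / 10)
    (hs : ∀ (i : Fin (d + 1)) (T : Finset (Fin (d + 1))), i ∉ T →
      ∑ j ∈ T, K.epsPos i j ≤ 1 - δ)
    {τ : Finset V} (hτ : K.IsFace τ) (hcard : τ.card + 2 = d + 1) (f : V → ℝ) :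
    ∑ x, ∑ y, K.pairMass τ x y * f x * f y -
      (∑ x, K.mass τ x * f x) ^ 2 / K.faceWeight τ ≤
      ∑ x, K.diagBound (2 * η / δ) τ x * (K.mass τ x * f x ^ 2) := by
  have hk : (d : ℝ) + 1 - τ.card = 2 := by
    have : ((τ.card : ℝ) + 2) = d + 1 := by exact_mod_cast hcard
    linarith
  have hl := K.isLinkForm hconn hτ hcard.le
  rw [hk] at hl
  have hc := K.card_missing hτ
  obtain ⟨i, j, hij, hm⟩ := Finset.card_eq_two.1 (by omega : (K.missing τ).card = 2)
  have hcomm : K.epsPos j i = K.epsPos i j := by rw [epsPos, epsPos, eps_comm]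
  have h1 := K.form_le_of_lambda2_le hτ hl hk (le_max_right (K.eps i j) 0)
    ((K.lambda2_le_eps hτ hm).trans (le_max_left _ _)) f
  refine h1.trans ?_
  rw [Finset.mul_sum]
  refine Finset.sum_le_sum fun x _ => ?_
  rcases (K.mass_nonneg τ x).eq_or_lt with hx | hx
  · simp [← hx]
  refine mul_le_mul_of_nonneg_right ?_ (mul_nonneg hx.le (sq_nonneg _))
  rw [WeightedComplex.mass_pos_iff] at hx
  have hsing : ∀ a b, a ≠ b → K.epsPos a b ≤ trickleBound (2 * η / δ) (K.epsPos a) {b} :=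
    fun a b hab => le_trickleBound_singleton hδ0 hη0 hη b (le_max_right _ _)
      (by simpa using hs a {b} (by simpa using hab)) (by omega)
  have hvx := K.vtype_mem_missing hx.1 hx.2
  rw [diagBound, missing_insert]
  rw [hm, Finset.mem_insert, Finset.mem_singleton] at hvx
  rw [hm]
  rcases hvx with hvx | hvx
  · have : ({i, j} : Finset (Fin (d + 1))).erase i = {j} := by
      rw [Finset.erase_insert (by simpa using hij)]
    rw [hvx, this]
    exact hsing i j hij
  · have : ({i, j} : Finset (Fin (d + 1))).erase j = {i} := by
      rw [Finset.pair_comm, Finset.erase_insert (by simpa using hij.symm)]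
    rw [hvx, this]
    exact hcomm.symm.le.trans (hsing j i hij.symm)

theorem form_le_diagBound_step (hconn : K.TotallyConnected)
    (hδ0 : 0 < δ) (hδ1 : δ < 1) (hη0 : 0 ≤ η) (hη : η * harm d ≤ δ ^ 2 / 10)
    (he : ∀ i j : Fin (d + 1), j ≠ i → K.epsPos i j ≤ η)
    (hs : ∀ (i : Fin (d + 1)) (T : Finset (Fin (d + 1))), i ∉ T →
      ∑ j ∈ T, K.epsPos i j ≤ 1 - δ)
    {τ : Finset V} (hτ : K.IsFace τ) (hcard : τ.card + 3 ≤ d + 1)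
    (ih : ∀ z ∉ τ, K.IsFace (insert z τ) → ∀ f : V → ℝ,
      ∑ x, ∑ y, K.pairMass (insert z τ) x y * f x * f y -
        (∑ x, K.mass (insert z τ) x * f x) ^ 2 / K.faceWeight (insert z τ) ≤
      ∑ x, K.diagBound (2 * η / δ) (insert z τ) x * (K.mass (insert z τ) x * f x ^ 2))
    (f : V → ℝ) :
    ∑ x, ∑ y, K.pairMass τ x y * f x * f y -
      (∑ x, K.mass τ x * f x) ^ 2 / K.faceWeight τ ≤
      ∑ x, K.diagBound (2 * η / δ) τ x * (K.mass τ x * f x ^ 2) := by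
  have hl := K.isLinkForm hconn hτ (by omega)
  set k : ℝ := (d : ℝ) + 1 - τ.card with hk
  have hk3 : 3 ≤ k := by
    have : ((τ.card : ℝ) + 3) ≤ d + 1 := by exact_mod_cast hcard
    linarith
  have hlinks : ∀ f : V → ℝ, ∑ z, (if z ∈ τ then 0 else
      ∑ x, ∑ y, K.pairMass (insert z τ) x y * f x * f y) =
      (k - 2) * ∑ x, ∑ y, K.pairMass τ x y * f x * f y := by
    intro f
    calc _ = ∑ z, ∑ x, ∑ y, (if z ∈ τ then 0 else K.pairMass (insert z τ) x y) * f x * f y := by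
          refine Finset.sum_congr rfl fun z _ => ?_
          by_cases hz : z ∈ τ <;> simp [hz]
      _ = ∑ x, ∑ y, (∑ z, if z ∈ τ then 0 else K.pairMass (insert z τ) x y) * f x * f y := by
          rw [Finset.sum_comm]
          refine Finset.sum_congr rfl fun x _ => ?_
          rw [Finset.sum_comm]
          refine Finset.sum_congr rfl fun y _ => ?_
          rw [Finset.sum_mul, Finset.sum_mul]
      _ = _ := by
          simp only [K.sum_pairMass_insert τ, Finset.mul_sum]
          exact Finset.sum_congr rfl fun x _ => Finset.sum_congr rfl fun y _ => by rw [hk]; ring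
  have hmass : ∀ z ∉ τ, K.pairMass τ z = K.mass (insert z τ) := by
    intro z hz
    ext x
    rw [WeightedComplex.pairMass, if_neg hz]
  have hweight : ∀ z ∉ τ, K.mass τ z = K.faceWeight (insert z τ) := by
    intro z hz
    rw [WeightedComplex.mass, if_neg hz]
  have hzero : ∀ z, (¬ (z ∉ τ ∧ K.IsFace (insert z τ))) → (∀ x, K.pairMass τ z x = 0) ∧
      ∀ f : V → ℝ, (if z ∈ τ then 0 else
        ∑ x, ∑ y, K.pairMass (insert z τ) x y * f x * f y) = 0 := by
    intro z hz
    by_cases hzτ : z ∈ τ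
    · simp [hzτ, WeightedComplex.pairMass]
    · have hnf : ¬ K.IsFace (insert z τ) := fun h => hz ⟨hzτ, h⟩
      refine ⟨fun x => by rw [hmass z hzτ, K.mass_eq_zero hnf], fun f => ?_⟩
      rw [if_neg hzτ]
      refine Finset.sum_eq_zero fun x _ => Finset.sum_eq_zero fun y _ => ?_
      have : K.pairMass (insert z τ) x y = 0 := by
        rw [WeightedComplex.pairMass]
        split_ifs
        · rfl
        · exact K.mass_eq_zero (fun ⟨η, hη, h'⟩ =>
            hnf ⟨η, hη, (Finset.subset_insert _ _).trans h'⟩) y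
      rw [this]; ring
  refine hl.form_le_diagonal _ ?_ (hl.form_le_of_links hk3 ?_) f
  · intro f
    have hz : ∀ z, (if z ∈ τ then 0 else
        ∑ x, ∑ y, K.pairMass (insert z τ) x y * f x * f y) ≤
        (∑ x, K.pairMass τ z x * f x) ^ 2 / K.mass τ z +
        ∑ x, K.diagBound (2 * η / δ) (insert z τ) x * (K.pairMass τ z x * f x ^ 2) := by
      intro z
      by_cases hz : z ∉ τ ∧ K.IsFace (insert z τ)
      · rw [if_neg hz.1, hmass z hz.1, hweight z hz.1]
        linarith [ih z hz.1 hz.2 f]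
      · rw [(hzero z hz).2]
        simp [(hzero z hz).1]
    have hsum := Finset.sum_le_sum fun z (_ : z ∈ Finset.univ) => hz z
    rw [hlinks, Finset.sum_add_distrib] at hsum
    have hdiag : ∑ z, ∑ x, K.diagBound (2 * η / δ) (insert z τ) x *
        (K.pairMass τ z x * f x ^ 2) ≤ ∑ x, K.mass τ x * f x ^ 2 *
        ((k - 2) * K.diagBound (2 * η / δ) τ x - K.diagBound (2 * η / δ) τ x ^ 2) := by
      rw [Finset.sum_comm]
      refine Finset.sum_le_sum fun x _ => ?_
      rcases (K.mass_nonneg τ x).eq_or_lt with hx | hx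
      · have : ∀ z, K.pairMass τ z x = 0 := fun z => by
          rw [K.pairMass_symm, hl.pair_eq_zero x z hx.symm]
        simp [this, ← hx]
      have hx' := (K.mass_pos_iff τ x).1 hx
      have hcx := K.card_missing hx'.2
      rw [Finset.card_insert_of_notMem hx'.1] at hcx
      set T := K.missing (insert x τ) with hT
      have hvT : K.vtype x ∉ T := K.vtype_notMem_missing_insert τ x
      have h1 : ∑ z, K.diagBound (2 * η / δ) (insert z τ) x * (K.pairMass τ z x * f x ^ 2) =
          f x ^ 2 * (K.mass τ x * ∑ j ∈ T,
            trickleBound (2 * η / δ) (K.epsPos (K.vtype x)) (T.erase j)) := by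
        rw [hweight x hx'.1, ← K.sum_mass_mul_vtype (insert x τ) fun j =>
          trickleBound (2 * η / δ) (K.epsPos (K.vtype x)) (T.erase j), Finset.mul_sum]
        refine Finset.sum_congr rfl fun z _ => ?_
        rw [K.pairMass_symm, hmass x hx'.1, diagBound, Finset.insert_comm, missing_insert]
        ring
      have h2 := sum_trickleBound_erase_le (T := T) (e := K.epsPos (K.vtype x)) hδ0 hδ1 hη0 hη
        (fun _ _ => le_max_right _ _)
        (fun j hj => he (K.vtype x) j fun h => hvT (h ▸ hj)) (hs _ T hvT) (by omega) (by omega)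
      have hTk : (T.card : ℝ) - 1 = k - 2 := by
        have : (T.card : ℝ) + (τ.card + 1) = d + 1 := by exact_mod_cast hcx
        rw [hk]; linarith
      rw [hTk] at h2
      rw [h1, diagBound, ← hT]
      have h3 := mul_le_mul_of_nonneg_left h2 (mul_nonneg hx.le (sq_nonneg (f x)))
      refine le_trans (le_of_eq ?_) h3
      ring
    linarith
  · intro f
    have hz : ∀ z, (if z ∈ τ then 0 else
        ∑ x, ∑ y, K.pairMass (insert z τ) x y * f x * f y) ≤
        (k - 2) / (k - 1) * ((∑ x, K.pairMass τ z x * f x) ^ 2 / K.mass τ z) +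
        (k - 2) / 8 * (∑ x, K.pairMass τ z x * f x ^ 2 -
          1 / (k - 1) * ((∑ x, K.pairMass τ z x * f x) ^ 2 / K.mass τ z)) := by
      intro z
      by_cases hz : z ∉ τ ∧ K.IsFace (insert z τ)
      · have hcz : (insert z τ).card = τ.card + 1 := Finset.card_insert_of_notMem hz.1
        have hlz := K.isLinkForm hconn hz.2 (by omega)
        have hkz : (d : ℝ) + 1 - (insert z τ).card = k - 1 := by
          rw [hcz, hk]; push_cast; ring
        rw [hkz] at hlz
        rw [if_neg hz.1, hmass z hz.1, hweight z hz.1]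
        have h1 := hlz.form_le_of_center (c := (k - 2) / 8) (fun g => by
          refine (ih z hz.1 hz.2 g).trans ?_
          rw [Finset.mul_sum]
          refine Finset.sum_le_sum fun x _ => ?_
          rcases (K.mass_nonneg (insert z τ) x).eq_or_lt with hx | hx
          · simp [← hx]
          refine mul_le_mul_of_nonneg_right ?_ (mul_nonneg hx.le (sq_nonneg _))
          rw [WeightedComplex.mass_pos_iff] at hx
          have hcx := K.card_missing hx.2
          rw [Finset.card_insert_of_notMem hx.1, hcz] at hcx
          have hvT := K.vtype_notMem_missing_insert (insert z τ) x
          have h2 := trickleBound_le_card hδ0 hδ1 hη0 hη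
            (fun j hj => he (K.vtype x) j fun h => hvT (h ▸ hj)) (hs _ _ hvT) (by omega) (by omega)
          have hTk : ((K.missing (insert x (insert z τ))).card : ℝ) = k - 2 := by
            have : ((K.missing (insert x (insert z τ))).card : ℝ) + (τ.card + 1 + 1) = d + 1 := by
              exact_mod_cast hcx
            rw [hk]; linarith
          rw [hTk] at h2
          exact h2) f
        rw [show k - 1 - 1 = k - 2 by ring] at h1
        exact h1
      · rw [(hzero z hz).2]
        simp [(hzero z hz).1]
    have hsum := Finset.sum_le_sum fun z (_ : z ∈ Finset.univ) => hz z
    rw [hlinks, Finset.sum_add_distrib, ← Finset.mul_sum, ← Finset.mul_sum,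
      Finset.sum_sub_distrib, ← Finset.mul_sum, hl.sum_sum_right fun x => f x ^ 2] at hsum
    have hk2 : 0 < k - 2 := by linarith
    refine le_of_mul_le_mul_left ?_ hk2
    set A := ∑ z, (∑ x, K.pairMass τ z x * f x) ^ 2 / K.mass τ z
    have : (k - 2) / (k - 1) * A = (k - 2) * (1 / (k - 1) * A) := by ring
    linarith

theorem form_le_diagBound (hconn : K.TotallyConnected)
    (hδ0 : 0 < δ) (hδ1 : δ < 1) (hη0 : 0 ≤ η) (hη : η * harm d ≤ δ ^ 2 / 10)
    (he : ∀ i j : Fin (d + 1), j ≠ i → K.epsPos i j ≤ η)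
    (hs : ∀ (i : Fin (d + 1)) (T : Finset (Fin (d + 1))), i ∉ T →
      ∑ j ∈ T, K.epsPos i j ≤ 1 - δ) {k : ℕ} (hk : 2 ≤ k) :
    ∀ {τ : Finset V}, K.IsFace τ → τ.card + k = d + 1 → ∀ f : V → ℝ,
    ∑ x, ∑ y, K.pairMass τ x y * f x * f y -
      (∑ x, K.mass τ x * f x) ^ 2 / K.faceWeight τ ≤
      ∑ x, K.diagBound (2 * η / δ) τ x * (K.mass τ x * f x ^ 2) := by
  induction k, hk using Nat.le_induction with
  | base => exact fun hτ hcard => K.form_le_diagBound_two hconn hδ0 hη0 hη hs hτ hcard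
  | succ k hk ih =>
    intro τ hτ hcard
    refine K.form_le_diagBound_step hconn hδ0 hδ1 hη0 hη he hs hτ (by omega) ?_
    intro z hz hface
    exact ih hface (by rw [Finset.card_insert_of_notMem hz]; omega)

end Trickle

end PartiteWeightedComplex

open WeightedComplex PartiteWeightedComplex in
/-- Trickle down for partite complexes under an averaged condition on the `ε_{i,j}`'s,
weighted by tails of the harmonic series. -/
theorem trickle_down_partite_average
    {V : Type*} [Fintype V] [DecidableEq V] {d : ℕ}
    (K : PartiteWeightedComplex V d)
    (hconn : K.toWeightedComplex.TotallyConnected)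
    (δ : ℝ) (hδ0 : 0 < δ) (hδ1 : δ < 1)
    (h1 : ∀ i j : Fin (d + 1), j ≠ i → K.eps i j * harm d ≤ δ ^ 2 / 10)
    (h2 : ∀ i : Fin (d + 1), ∀ j : Fin d → Fin (d + 1), Function.Injective j →
      (∀ ℓ, j ℓ ≠ i) →
      (∀ ℓ ℓ' : Fin d, ℓ ≤ ℓ' → K.eps i (j ℓ') ≤ K.eps i (j ℓ)) →
      ∑ ℓ : Fin d, K.eps i (j ℓ) * harmFrom d (ℓ : ℕ) / (d : ℝ) ≤ (1 - δ) / (d : ℝ)) :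
    ∀ k : ℕ, 2 ≤ k → k ≤ d + 1 →
      ∀ τ : Finset V, K.toWeightedComplex.IsFace τ → τ.card = d + 1 - k →
        lambda2 (K.toWeightedComplex.walkMatrix τ) ≤
          2 * (1 - δ) / (((k : ℝ) - 1) * δ) := by
  intro k hk2 hkd τ hτ hcard
  have hd : 1 ≤ d := by omega
  have hcard' : τ.card + k = d + 1 := by omega
  have hH : 0 < harm d := zero_lt_one.trans_le (one_le_harm hd)
  have hη0 : 0 ≤ δ ^ 2 / 10 / harm d := by positivity
  have hη : δ ^ 2 / 10 / harm d * harm d ≤ δ ^ 2 / 10 := (div_mul_cancel₀ _ hH.ne').le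
  have he : ∀ i j : Fin (d + 1), j ≠ i → K.epsPos i j ≤ δ ^ 2 / 10 / harm d :=
    fun i j hij => max_le ((le_div_iff₀ hH).2 (h1 i j hij)) hη0
  have hs : ∀ (i : Fin (d + 1)) (T : Finset (Fin (d + 1))), i ∉ T →
      ∑ j ∈ T, K.epsPos i j ≤ 1 - δ :=
    fun i T hi => K.sum_epsPos_le hd (by linarith) i (h2 i) T hi
  have hkr : (k : ℝ) = (d : ℝ) + 1 - τ.card := by
    have : ((τ.card : ℝ) + k) = d + 1 := by exact_mod_cast hcard'
    linarith
  have hl := K.isLinkForm hconn hτ (by omega)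
  rw [← hkr] at hl
  have hc0 : 0 ≤ 2 * (1 - δ) / δ := div_nonneg (by linarith) hδ0.le
  have hmain := K.lambda2_le_of_form_le hτ hl hkr hc0 fun f => by
    refine (K.form_le_diagBound hconn hδ0 hδ1 hη0 hη he hs hk2 hτ hcard' f).trans ?_
    rw [Finset.mul_sum]
    refine Finset.sum_le_sum fun x _ => ?_
    rcases (K.mass_nonneg τ x).eq_or_lt with hx | hx
    · simp [← hx]
    · exact mul_le_mul_of_nonneg_right (K.diagBound_le hδ0 hη0 hη hs hx)
        (mul_nonneg hx.le (sq_nonneg _))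
  rwa [div_div, mul_comm δ] at hmain
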